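/- Let X : ℝ → ℝ³ be three times continuously differentiable with ‖X′(s)‖ = 1 for all s, write τ = X′, and let f : ℝ → ℝ³ be continuously differentiable. Fix s ∈ ℝ. Then X(s′) ≠ X(s) for all s′ ≠ s sufficiently close to s, and the singularity-subtracted rotlet integrand g_rt(s′) = (1/(s′ − s)) [ ( |s′ − s| / ‖R(s′)‖³ ) ⟨R(s′) × τ(s), f(s′)⟩ − (1/2) ⟨τ(s) × τ′(s), f(s)⟩ ], where R(s′) = X(s) − X(s′), converges, as s′ → s with s′ ≠ s, to −(1/2) ⟨f′(s), τ′(s) × τ(s)⟩ − (1/6) ⟨f(s), τ″(s) × τ(s)⟩. In particular g_rt has a removable singularity at s′ = s. -/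

import Mathlib

open scoped RealInnerProductSpace Topology

noncomputable section

/-- ℝ³ with the Euclidean inner product and norm. -/
abbrev E3 : Type := EuclideanSpace ℝ (Fin 3)

/-- The cross product on ℝ³. -/
def cross3 (u v : E3) : E3 :=
  !₂[u 1 * v 2 - u 2 * v 1, u 2 * v 0 - u 0 * v 2, u 0 * v 1 - u 1 * v 0]

open Filter

lemma inner3 (u v : E3) : ⟪u, v⟫ = u 0 * v 0 + u 1 * v 1 + u 2 * v 2 := by
  simp [PiLp.inner_apply, Fin.sum_univ_three, mul_comm]

lemma continuous_cross3 : Continuous (fun p : E3 × E3 => cross3 p.1 p.2) := by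
  unfold cross3
  refine (PiLp.continuous_toLp 2 _).comp (continuous_pi fun i => ?_)
  fin_cases i <;> simp <;> fun_prop

lemma taylor3 (X : ℝ → E3) (hX : ContDiff ℝ 3 X) (s : ℝ) :
    ∃ Q : ℝ → E3, Tendsto Q (𝓝[≠] s) (𝓝 ((1 / 6 : ℝ) • deriv (deriv (deriv X)) s)) ∧
      ∀ x, x ≠ s → X x = X s + (x - s) • (deriv X s + (x - s) •
        ((1 / 2 : ℝ) • deriv (deriv X) s + (x - s) • Q x)) := by
  have h := taylor_tendsto (f := X) (n := 3) convex_univ (Set.mem_univ s) hX.contDiffOn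
  rw [nhdsWithin_univ] at h
  have h2 := (h.mono_left (nhdsWithin_le_nhds (s := {s}ᶜ))).add_const
    ((1 / 6 : ℝ) • deriv (deriv (deriv X)) s)
  rw [zero_add] at h2
  refine ⟨_, h2, fun x hx => ?_⟩
  have hx' : x - s ≠ 0 := sub_ne_zero.2 hx
  simp only [taylorWithinEval_succ, taylor_within_zero_eval, iteratedDerivWithin_univ,
    iteratedDeriv_succ, iteratedDeriv_zero]
  ext i
  simp
  norm_num [Nat.factorial]
  field_simp
  ring

lemma diff1 (f : ℝ → E3) (hf : ContDiff ℝ 1 f) (s : ℝ) :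
    ∃ F : ℝ → E3, Tendsto F (𝓝[≠] s) (𝓝 (deriv f s)) ∧
      ∀ x, x ≠ s → f x = f s + (x - s) • F x := by
  have h := ((hf.differentiable (by simp)) s).hasDerivAt
  rw [hasDerivAt_iff_tendsto_slope] at h
  refine ⟨_, h, fun x hx => ?_⟩
  have hx' : x - s ≠ 0 := sub_ne_zero.2 hx
  simp [slope, smul_smul, mul_inv_cancel₀ hx']

lemma inner_tau (X : ℝ → E3) (hX : ContDiff ℝ 3 X) (hunit : ∀ s, ‖deriv X s‖ = 1) (s : ℝ) :
    ⟪deriv X s, deriv (deriv X) s⟫ = 0 := by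
  have hd : ContDiff ℝ 2 (deriv X) := by
    have : ContDiff ℝ (2 + 1) X := by norm_num; exact hX
    exact (contDiff_succ_iff_deriv.1 this).2.2
  have h := ((hd.differentiable (by simp)) s).hasDerivAt
  have h2 := h.inner ℝ h
  have h3 : (fun t => ⟪deriv X t, deriv X t⟫) = fun _ => (1 : ℝ) := by
    funext t; rw [real_inner_self_eq_norm_sq, hunit]; norm_num
  rw [h3] at h2
  have h4 := h2.unique (hasDerivAt_const s (1 : ℝ))
  rw [real_inner_comm (deriv X s) (deriv (deriv X) s)] at h4
  linarith

/-- The singularity-subtracted rotlet integrand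
`g_rt(s′) = (s′ − s)⁻¹ [ (|s′ − s| / ‖R(s′)‖³) ⟨R(s′) × τ(s), f(s′)⟩
  − (1/2) ⟨τ(s) × τ′(s), f(s)⟩ ]` with `R(s′) = X(s) − X(s′)`
has a removable singularity at `s′ = s`: near (but not at) `s`, `X(s′) ≠ X(s)`, and as
`s′ → s` with `s′ ≠ s`, `g_rt(s′)` converges to
`−(1/2) ⟨f′(s), τ′(s) × τ(s)⟩ − (1/6) ⟨f(s), τ″(s) × τ(s)⟩`, where `τ = X′`. -/
theorem rotlet_integrand_removable_singularity
    (X : ℝ → E3) (hX : ContDiff ℝ 3 X) (hunit : ∀ s, ‖deriv X s‖ = 1)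
    (f : ℝ → E3) (hf : ContDiff ℝ 1 f) (s : ℝ) :
    (∀ᶠ s' in 𝓝[≠] s, X s' ≠ X s) ∧
    Filter.Tendsto
      (fun s' : ℝ => (s' - s)⁻¹ *
        ((|s' - s| / ‖X s - X s'‖ ^ 3) * ⟪cross3 (X s - X s') (deriv X s), f s'⟫
          - (1 / 2 : ℝ) * ⟪cross3 (deriv X s) (deriv (deriv X) s), f s⟫))
      (𝓝[≠] s)
      (𝓝 (-(1 / 2 : ℝ) * ⟪deriv f s, cross3 (deriv (deriv X) s) (deriv X s)⟫
        - (1 / 6 : ℝ) * ⟪f s, cross3 (deriv (deriv (deriv X)) s) (deriv X s)⟫)) := by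
  obtain ⟨Q, hQ, hXQ⟩ := taylor3 X hX s
  obtain ⟨F, hF, hfF⟩ := diff1 f hf s
  have h0 := inner_tau X hX hunit s
  have hn := hunit s
  set t := deriv X s
  set t1 := deriv (deriv X) s
  set t2 := deriv (deriv (deriv X)) s
  have hne : ∀ᶠ x in 𝓝[≠] s, x ≠ s := eventually_mem_nhdsWithin
  have hh : Tendsto (fun x : ℝ => x - s) (𝓝[≠] s) (𝓝 0) := by
    have : Tendsto (fun x : ℝ => x - s) (𝓝 s) (𝓝 (s - s)) := (continuous_sub_right s).tendsto s
    rw [sub_self] at this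
    exact this.mono_left nhdsWithin_le_nhds
  obtain ⟨P, hPdef⟩ : ∃ P : ℝ → E3, P = fun x => (1 / 2 : ℝ) • t1 + (x - s) • Q x := ⟨_, rfl⟩
  have hP : Tendsto P (𝓝[≠] s) (𝓝 ((1 / 2 : ℝ) • t1)) := by
    rw [hPdef]; simpa using (hh.smul hQ).const_add ((1 / 2 : ℝ) • t1)
  obtain ⟨N, hNdef⟩ : ∃ N : ℝ → ℝ, N = fun x => ‖t + (x - s) • P x‖ := ⟨_, rfl⟩
  have hN : Tendsto N (𝓝[≠] s) (𝓝 1) := by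
    rw [hNdef, ← hn]; simpa using ((hh.smul hP).const_add t).norm
  have hNpos : ∀ᶠ x in 𝓝[≠] s, 0 < N x := hN.eventually (lt_mem_nhds one_pos)
  have hR : ∀ x, x ≠ s → X s - X x = -((x - s) • (t + (x - s) • P x)) := by
    intro x hx; rw [hXQ x hx, hPdef]; abel
  have hRn : ∀ x, x ≠ s → ‖X s - X x‖ = |x - s| * N x := by
    intro x hx; rw [hR x hx, norm_neg, norm_smul, Real.norm_eq_abs, hNdef]
  refine ⟨?_, ?_⟩
  · filter_upwards [hne, hNpos] with x hx hp hc
    have := hRn x hx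
    rw [hc, sub_self, norm_zero] at this
    have : 0 < |x - s| * N x := mul_pos (abs_pos.2 (sub_ne_zero.2 hx)) hp
    linarith
  have hM : Tendsto (fun x => 2 * ⟪t, P x⟫ + (x - s) * ‖P x‖ ^ 2) (𝓝[≠] s) (𝓝 0) := by
    have := ((tendsto_const_nhds (x := t)).inner (𝕜 := ℝ) hP).const_mul 2 |>.add
      (hh.mul (hP.norm.pow 2))
    simpa [inner_smul_right, h0] using this
  have hfs : Tendsto f (𝓝[≠] s) (𝓝 (f s)) := (hf.continuous.tendsto s).mono_left nhdsWithin_le_nhds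
  have hcr : ∀ {G : ℝ → E3} {g : E3}, Tendsto G (𝓝[≠] s) (𝓝 g) →
      Tendsto (fun x => cross3 (G x) t) (𝓝[≠] s) (𝓝 (cross3 g t)) := fun hG =>
    (continuous_cross3.tendsto (_, t)).comp (hG.prodMk_nhds tendsto_const_nhds)
  have hK : Tendsto (fun x => (1 + N x + N x ^ 2) / ((1 + N x) * N x ^ 3)) (𝓝[≠] s)
      (𝓝 ((1 + 1 + 1 ^ 2) / ((1 + 1) * 1 ^ 3))) :=
    ((hN.const_add 1).add (hN.pow 2)).div ((hN.const_add 1).mul (hN.pow 3)) (by norm_num)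
  have key := (((hM.mul hK).mul ((hcr hP).inner (𝕜 := ℝ) hfs)).sub
    ((hcr hQ).inner (𝕜 := ℝ) hfs)).sub
    (((tendsto_const_nhds (x := cross3 t1 t)).inner (𝕜 := ℝ) hF).const_mul (1 / 2))
  refine (key.congr' ?_).trans_eq ?_
  · filter_upwards [hne, hNpos] with x hx hp
    have hx' : x - s ≠ 0 := sub_ne_zero.2 hx
    have hN2 : N x ^ 2 = 1 + (x - s) * (2 * ⟪t, P x⟫ + (x - s) * ‖P x‖ ^ 2) := by
      simp only [hNdef]
      rw [norm_add_sq_real, hn, inner_smul_right, norm_smul, mul_pow, Real.norm_eq_abs, sq_abs]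
      ring
    have hcross : ⟪cross3 (X s - X x) t, f x⟫ = -((x - s) ^ 2 * ⟪cross3 (P x) t, f x⟫) := by
      rw [hR x hx, inner3, inner3]; simp [cross3]; ring
    have hPx : ⟪cross3 (P x) t, f x⟫ = (1 / 2) * ⟪cross3 t1 t, f s⟫
        + (x - s) * ((1 / 2) * ⟪cross3 t1 t, F x⟫ + ⟪cross3 (Q x) t, f x⟫) := by
      rw [hfF x hx, hPdef]; simp only [inner3]; simp [cross3]; ring
    have hanti : ⟪cross3 t t1, f s⟫ = -⟪cross3 t1 t, f s⟫ := by
      simp only [inner3]; simp [cross3]; ring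
    have habs : |x - s| / ‖X s - X x‖ ^ 3 = 1 / ((x - s) ^ 2 * N x ^ 3) := by
      rw [hRn x hx, ← sq_abs (x - s)]
      have := abs_pos.2 hx'
      field_simp
    rw [habs, hcross, hanti]
    generalize ⟪cross3 (P x) t, f x⟫ = p at *
    generalize 2 * ⟪t, P x⟫ + (x - s) * ‖P x‖ ^ 2 = m at *
    generalize ⟪cross3 t1 t, f s⟫ = a at *
    generalize ⟪cross3 t1 t, F x⟫ = b at *
    generalize ⟪cross3 (Q x) t, f x⟫ = c at *
    generalize N x = n at *
    generalize x - s = h at *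
    have hm : m = (n ^ 2 - 1) / h := by field_simp; linarith
    have hc : c = (p - 1 / 2 * a) / h - 1 / 2 * b := by rw [hPx]; field_simp; ring
    rw [hm, hc]
    have : 1 + n ≠ 0 := by positivity
    field_simp
    ring
  · congr 1
    simp only [inner3]; simp [cross3]; ring
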